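/- Let 0 < α < 1 and let h_α(t) := Σ_{k=0}^∞ 2^{−kα} cos(2π·2^k t). Then there exists a constant c > 0 such that for every y ∈ (0,1), ∫_0^1 |h_α(t) − h_α(t − y)| dt ≥ c · min(|y|, 1 − |y|)^α. -/

import Mathlib

/-- The Weierstrass function `h_α(t) = Σ_{k≥0} 2^{−kα} cos(2π·2^k t)`. -/
noncomputable def weierstrass (α : ℝ) (t : ℝ) : ℝ :=
  ∑' k : ℕ, (2:ℝ) ^ (-(k:ℝ) * α) * Real.cos (2 * Real.pi * 2 ^ k * t)

theorem integral_cos_int_mul_sub {k : ℤ} (hk : k ≠ 0) (b : ℝ) :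
    ∫ t in (0:ℝ)..1, Real.cos (2 * Real.pi * k * t - b) = 0 := by
  have hc : 2 * Real.pi * (k : ℝ) ≠ 0 := by
    have : (k : ℝ) ≠ 0 := by exact_mod_cast hk
    have := Real.pi_ne_zero
    positivity
  rw [intervalIntegral.integral_comp_mul_sub (fun x => Real.cos x) hc, integral_cos]
  have h : Real.sin (2 * Real.pi * k * 1 - b) = Real.sin (2 * Real.pi * k * 0 - b) := by
    rw [← Real.sin_add_int_mul_two_pi (2 * Real.pi * k * 0 - b) k]
    ring_nf
  rw [h, sub_self, smul_zero]

theorem integral_cos_mul_cos_shift {m n : ℕ} (hn : 0 < n) (y : ℝ) :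
    ∫ t in (0:ℝ)..1, Real.cos (2 * Real.pi * m * (t - y)) * Real.cos (2 * Real.pi * n * t) =
      if m = n then Real.cos (2 * Real.pi * n * y) / 2 else 0 := by
  have hprod : ∀ t : ℝ,
      Real.cos (2 * Real.pi * m * (t - y)) * Real.cos (2 * Real.pi * n * t) =
        (1 / 2) * (Real.cos (2 * Real.pi * ((m + n : ℤ) : ℝ) * t - 2 * Real.pi * m * y) +
          Real.cos (2 * Real.pi * ((m - n : ℤ) : ℝ) * t - 2 * Real.pi * m * y)) := by
    intro t
    have h1 : 2 * Real.pi * ((m + n : ℤ) : ℝ) * t - 2 * Real.pi * m * y =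
        2 * Real.pi * m * (t - y) + 2 * Real.pi * n * t := by push_cast; ring
    have h2 : 2 * Real.pi * ((m - n : ℤ) : ℝ) * t - 2 * Real.pi * m * y =
        2 * Real.pi * m * (t - y) - 2 * Real.pi * n * t := by push_cast; ring
    rw [h1, h2, Real.cos_add, Real.cos_sub]
    ring
  simp_rw [hprod]
  rw [intervalIntegral.integral_const_mul, intervalIntegral.integral_add
    (Continuous.intervalIntegrable (by fun_prop) _ _)
    (Continuous.intervalIntegrable (by fun_prop) _ _),
    integral_cos_int_mul_sub (by lia)]
  split_ifs with h
  · subst h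
    simp
    ring
  · rw [integral_cos_int_mul_sub (by lia)]
    simp

theorem summable_two_rpow_neg_mul {α : ℝ} (hα : 0 < α) :
    Summable fun k : ℕ => (2:ℝ) ^ (-(k:ℝ) * α) := by
  have h : (fun k : ℕ => (2:ℝ) ^ (-(k:ℝ) * α)) = fun k : ℕ => ((2:ℝ) ^ (-α)) ^ k := by
    ext k
    rw [← Real.rpow_natCast, ← Real.rpow_mul (by norm_num)]
    ring_nf
  rw [h]
  exact summable_geometric_of_lt_one (by positivity)
    (Real.rpow_lt_one_of_one_lt_of_neg (by norm_num) (by linarith))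

theorem norm_weierstrass_term_le (α t : ℝ) (k : ℕ) :
    ‖(2:ℝ) ^ (-(k:ℝ) * α) * Real.cos (2 * Real.pi * 2 ^ k * t)‖ ≤ (2:ℝ) ^ (-(k:ℝ) * α) := by
  rw [norm_mul, Real.norm_of_nonneg (by positivity : (0:ℝ) ≤ (2:ℝ) ^ (-(k:ℝ) * α))]
  exact mul_le_of_le_one_right (by positivity) (Real.abs_cos_le_one _)

theorem continuous_weierstrass {α : ℝ} (hα : 0 < α) : Continuous (weierstrass α) :=
  continuous_tsum (fun k => by fun_prop) (summable_two_rpow_neg_mul hα)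
    (fun k t => norm_weierstrass_term_le α t k)

/-- The cosine coefficients of translates of the Weierstrass function. -/
theorem integral_weierstrass_sub_mul_cos {α : ℝ} (hα : 0 < α) (y : ℝ) (n : ℕ) :
    ∫ t in (0:ℝ)..1, weierstrass α (t - y) * Real.cos (2 * Real.pi * 2 ^ n * t) =
      (2:ℝ) ^ (-(n:ℝ) * α) * (Real.cos (2 * Real.pi * 2 ^ n * y) / 2) := by
  have hs := summable_two_rpow_neg_mul hα
  have hsum := intervalIntegral.hasSum_integral_of_dominated_convergence
    (μ := MeasureTheory.volume) (a := 0) (b := 1)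
    (F := fun (k : ℕ) t => (2:ℝ) ^ (-(k:ℝ) * α) * Real.cos (2 * Real.pi * 2 ^ k * (t - y)) *
      Real.cos (2 * Real.pi * 2 ^ n * t))
    (f := fun t => weierstrass α (t - y) * Real.cos (2 * Real.pi * 2 ^ n * t))
    (fun (k : ℕ) _ => (2:ℝ) ^ (-(k:ℝ) * α))
    (fun k => Continuous.aestronglyMeasurable (by fun_prop))
    (fun k => .of_forall fun t _ => by
      rw [norm_mul]
      exact (mul_le_of_le_one_right (norm_nonneg _) (Real.abs_cos_le_one _)).trans
        (norm_weierstrass_term_le α (t - y) k))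
    (.of_forall fun t _ => hs)
    (by simp)
    (.of_forall fun t _ => (Summable.of_norm_bounded hs
      (norm_weierstrass_term_le α (t - y))).hasSum.mul_right _)
  refine hsum.unique ?_
  have hterm : ∀ k : ℕ, ∫ t in (0:ℝ)..1, (2:ℝ) ^ (-(k:ℝ) * α) *
      Real.cos (2 * Real.pi * 2 ^ k * (t - y)) * Real.cos (2 * Real.pi * 2 ^ n * t) =
      if k = n then (2:ℝ) ^ (-(n:ℝ) * α) * (Real.cos (2 * Real.pi * 2 ^ n * y) / 2) else 0 := by
    intro k
    have h := integral_cos_mul_cos_shift (m := 2 ^ k) (n := 2 ^ n) (by positivity) y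
    push_cast at h
    simp_rw [mul_assoc ((2:ℝ) ^ (-(k:ℝ) * α))]
    rw [intervalIntegral.integral_const_mul, h]
    simp only [Nat.pow_right_injective le_rfl |>.eq_iff]
    split_ifs with hkn
    · rw [hkn]
    · simp
  simp_rw [hterm]
  exact hasSum_ite_eq n _

theorem abs_integral_mul_cos_le {f : ℝ → ℝ} (hf : Continuous f) (a : ℝ) :
    |∫ t in (0:ℝ)..1, f t * Real.cos (a * t)| ≤ ∫ t in (0:ℝ)..1, |f t| := by
  refine (intervalIntegral.abs_integral_le_integral_abs zero_le_one).trans ?_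
  refine intervalIntegral.integral_mono_on zero_le_one
    (Continuous.intervalIntegrable (by fun_prop) _ _)
    (Continuous.intervalIntegrable (by fun_prop) _ _) fun t _ => ?_
  rw [abs_mul]
  exact mul_le_of_le_one_right (abs_nonneg _) (Real.abs_cos_le_one _)

theorem cos_two_pi_pow_mul_min (n : ℕ) (y : ℝ) :
    Real.cos (2 * Real.pi * 2 ^ n * min y (1 - y)) = Real.cos (2 * Real.pi * 2 ^ n * y) := by
  rcases min_choice y (1 - y) with h | h <;> rw [h]
  rw [← Real.cos_nat_mul_two_pi_sub (2 * Real.pi * 2 ^ n * y) (2 ^ n)]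
  push_cast
  ring_nf

theorem exists_two_pow_mul_mem_Icc {x : ℝ} (hx0 : 0 < x) (hx : x ≤ 1 / 2) :
    ∃ n : ℕ, 1 / 4 ≤ 2 ^ n * x ∧ 2 ^ n * x ≤ 1 / 2 := by
  obtain ⟨n, h1, h2⟩ := exists_nat_pow_near (x := 1 / (2 * x)) (y := 2)
    (by rw [le_div_iff₀ (by positivity)]; linarith) (by norm_num)
  rw [le_div_iff₀ (by positivity)] at h1
  rw [div_lt_iff₀ (by positivity), pow_succ] at h2
  exact ⟨n, by linarith, by linarith⟩

/-- L¹ lower bound for increments of the Weierstrass function: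
`∫_0^1 |h_α(t) − h_α(t − y)| dt ≥ c ⟨y⟩^α` where `⟨y⟩ = min(|y|, 1−|y|)`. -/
theorem weierstrass_L1_lower_bound (α : ℝ) (hα0 : 0 < α) (hα1 : α < 1) :
    ∃ c : ℝ, 0 < c ∧ ∀ y ∈ Set.Ioo (0:ℝ) 1,
      c * (min |y| (1 - |y|)) ^ α ≤
        ∫ t in (0:ℝ)..1, |weierstrass α t - weierstrass α (t - y)| := by
  refine ⟨1 / 2, by norm_num, fun y ⟨hy0, hy1⟩ => ?_⟩
  rw [abs_of_pos hy0]
  have hx0 : 0 < min y (1 - y) := lt_min hy0 (by linarith)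
  have hx : min y (1 - y) ≤ 1 / 2 := by
    linarith [min_le_left y (1 - y), min_le_right y (1 - y)]
  obtain ⟨n, hn1, hn2⟩ := exists_two_pow_mul_mem_Icc hx0 hx
  have hcos : Real.cos (2 * Real.pi * 2 ^ n * y) ≤ 0 := by
    rw [← cos_two_pi_pow_mul_min]
    apply Real.cos_nonpos_of_pi_div_two_le_of_le <;> nlinarith [Real.pi_pos]
  have hpow : (min y (1 - y)) ^ α ≤ (2:ℝ) ^ (-(n:ℝ) * α) := by
    rw [Real.rpow_mul (by norm_num), Real.rpow_neg (by norm_num), Real.rpow_natCast]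
    refine Real.rpow_le_rpow hx0.le ?_ hα0.le
    rw [le_inv_comm₀ hx0 (by positivity), ← one_div, le_div_iff₀ hx0]
    linarith
  have hc := continuous_weierstrass hα0
  have hint : ∫ t in (0:ℝ)..1, (weierstrass α t - weierstrass α (t - y)) *
      Real.cos (2 * Real.pi * 2 ^ n * t) =
      (2:ℝ) ^ (-(n:ℝ) * α) * ((1 - Real.cos (2 * Real.pi * 2 ^ n * y)) / 2) := by
    have h0 := integral_weierstrass_sub_mul_cos hα0 0 n
    simp only [sub_zero, mul_zero, Real.cos_zero] at h0
    simp_rw [sub_mul]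
    rw [intervalIntegral.integral_sub (Continuous.intervalIntegrable (by fun_prop) _ _)
      (Continuous.intervalIntegrable (by fun_prop) _ _), h0,
      integral_weierstrass_sub_mul_cos hα0 y n]
    ring
  have hle := abs_integral_mul_cos_le (f := fun t => weierstrass α t - weierstrass α (t - y))
    (by fun_prop) (2 * Real.pi * 2 ^ n)
  refine le_trans ?_ ((le_abs_self _).trans hle)
  rw [hint]
  have : (0:ℝ) < (2:ℝ) ^ (-(n:ℝ) * α) := by positivity
  nlinarith
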